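/- Consider two cyclic dynamics (σ_t) and (σ̃_t) with p = 1/2 whose initial proportion vectors satisfy ‖S_0 − S̃_0‖_1 < 10/n. For every ε > 0 there exists γ > 0 (independent of n) such that under the semi-synchronized coupling, for every t ≥ γn, ℙ^{SC}_{σ_0, σ̃_0}( S_t = S̃_t ) ≥ 1 − ε; in particular there exists a Markovian coupling under which the two proportion chains coincide at time ⌈γn⌉ with probability at least 1 − ε. -/

import Mathlib

open Finset
open scoped Classical

/-- Configuration space `Σ_n = {1,2,3}^{V_n}`, colors encoded as `Fin 3`. -/
abbrev Config (n : ℕ) := Fin n → Fin 3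

/-- Transition matrix of the cyclic dynamics with parameter `p` on `Σ_n`. -/
noncomputable def cyclicP (n : ℕ) (p : ℝ) : Matrix (Config n) (Config n) ℝ :=
  Matrix.of fun σ τ => (1 / (n : ℝ)) * ∑ v : Fin n,
    ((1 - p) * (if τ = σ then (1 : ℝ) else 0)
      + p * (if τ = Function.update σ v (σ v + 1) then (1 : ℝ) else 0))

/-- Proportion vector `S(σ) ∈ ℝ³`. -/
noncomputable def propVec {n : ℕ} (σ : Config n) : Fin 3 → ℝ :=
  fun k => ((univ.filter fun v => σ v = k).card : ℝ) / n

/-- ℓ¹ norm on `ℝ³`. -/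
def l1 (x : Fin 3 → ℝ) : ℝ := ∑ k, |x k|

/-- A Markovian coupling of two copies of the cyclic dynamics: a transition matrix on
`Σ_n × Σ_n` with nonnegative entries whose marginal transitions are both `cyclicP n p`. -/
def IsCoupling (n : ℕ) (p : ℝ) (K : Matrix (Config n × Config n) (Config n × Config n) ℝ) : Prop :=
  (∀ x y, 0 ≤ K x y) ∧
  (∀ x : Config n × Config n, ∀ τ : Config n,
      ∑ τ' : Config n, K x (τ, τ') = cyclicP n p x.1 τ) ∧
  (∀ x : Config n × Config n, ∀ τ' : Config n,
      ∑ τ : Config n, K x (τ, τ') = cyclicP n p x.2 τ')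

/-- The semi-synchronized coupling property: the coupled proportion chains satisfy the
ℓ¹-contraction `E‖S_t − S̃_t‖₁ ≤ (1 − 1/(2n))^t ‖S_0 − S̃_0‖₁` from every start. -/
def IsSemiSynchronized (n : ℕ)
    (K : Matrix (Config n × Config n) (Config n × Config n) ℝ) : Prop :=
  ∀ (σ0 σ0' : Config n) (t : ℕ),
    ∑ y : Config n × Config n,
        (K ^ t) (σ0, σ0') y * l1 (propVec y.1 - propVec y.2)
      ≤ (1 - 1 / (2 * n)) ^ t * l1 (propVec σ0 - propVec σ0')

/-- The number of mismatched vertices when each `v` of the first configuration is matched with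
`π v` of the second one. -/
noncomputable def mismatch {n : ℕ} (σ σ' : Config n) (π : Equiv.Perm (Fin n)) : ℝ :=
  ∑ v, if σ v = σ' (π v) then (0 : ℝ) else 1

theorem propVec_eq_sum {n : ℕ} (σ : Config n) (k : Fin 3) :
    propVec σ k = (∑ v, if σ v = k then (1 : ℝ) else 0) / n := by
  simp [propVec]

theorem propVec_sub_eq_sum {n : ℕ} (σ σ' : Config n) (π : Equiv.Perm (Fin n)) (k : Fin 3) :
    (propVec σ - propVec σ') k =
      (∑ v, ((if σ v = k then (1 : ℝ) else 0) - if σ' (π v) = k then (1 : ℝ) else 0)) / n := by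
  rw [Pi.sub_apply, propVec_eq_sum, propVec_eq_sum, Finset.sum_sub_distrib, sub_div,
    Equiv.sum_comp π (fun v => if σ' v = k then (1 : ℝ) else 0)]

theorem sum_abs_indicator_sub (a b : Fin 3) :
    ∑ k, |(if a = k then (1 : ℝ) else 0) - if b = k then (1 : ℝ) else 0| =
      2 * if a = b then (0 : ℝ) else 1 := by
  fin_cases a <;> fin_cases b <;> simp [Fin.sum_univ_three] <;> norm_num

theorem mul_mismatch_eq_sum {n : ℕ} (σ σ' : Config n) (π : Equiv.Perm (Fin n)) :
    2 / n * mismatch σ σ' π = ∑ k, (∑ v, |(if σ v = k then (1 : ℝ) else 0)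
      - if σ' (π v) = k then (1 : ℝ) else 0|) / n := by
  rw [← Finset.sum_div, Finset.sum_comm]
  simp_rw [sum_abs_indicator_sub]
  rw [← Finset.mul_sum, mismatch]
  ring

/-- Every matching of the vertices bounds the `ℓ¹` distance of the proportion vectors. -/
theorem l1_le_mismatch {n : ℕ} (σ σ' : Config n) (π : Equiv.Perm (Fin n)) :
    l1 (propVec σ - propVec σ') ≤ 2 / n * mismatch σ σ' π := by
  rw [mul_mismatch_eq_sum, l1]
  refine Finset.sum_le_sum fun k _ => ?_
  rw [propVec_sub_eq_sum σ σ' π, abs_div, Nat.abs_cast]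
  gcongr
  exact Finset.abs_sum_le_sum_abs _ _

/-- Exchanging the partners of two mismatched vertices so that one of them becomes matched
decreases the mismatch. -/
theorem mismatch_mul_swap_lt {n : ℕ} {σ σ' : Config n} {π : Equiv.Perm (Fin n)} {u w : Fin n}
    (hu : σ u ≠ σ' (π u)) (hw : σ w ≠ σ' (π w)) (huw : σ u = σ' (π w)) :
    mismatch σ σ' (π * Equiv.swap u w) < mismatch σ σ' π := by
  refine Finset.sum_lt_sum (fun v _ => ?_) ⟨u, Finset.mem_univ u, ?_⟩
  · rcases eq_or_ne v u with rfl | hvu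
    · rw [if_pos (by simpa using huw)]
      split_ifs <;> norm_num
    rcases eq_or_ne v w with rfl | hvw
    · rw [if_neg hw]
      split_ifs <;> norm_num
    simp [Equiv.swap_apply_of_ne_of_ne hvu hvw]
  · rw [if_pos (by simpa using huw), if_neg hu]
    exact one_pos

/-- Some matching of the vertices realizes the `ℓ¹` distance of the proportion vectors. -/
theorem exists_perm_mismatch_eq {n : ℕ} (σ σ' : Config n) :
    ∃ π : Equiv.Perm (Fin n), l1 (propVec σ - propVec σ') = 2 / n * mismatch σ σ' π := by
  obtain ⟨π, hπ⟩ := Finite.exists_min (mismatch σ σ')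
  refine ⟨π, le_antisymm (l1_le_mismatch σ σ' π) ?_⟩
  rw [mul_mismatch_eq_sum, l1]
  refine Finset.sum_le_sum fun k _ => ?_
  rw [propVec_sub_eq_sum σ σ' π, abs_div, Nat.abs_cast]
  gcongr
  by_cases hk : ∃ u, σ u = k ∧ σ' (π u) ≠ k
  · obtain ⟨u, hu, hu'⟩ := hk
    refine le_trans (Finset.sum_le_sum fun w _ => ?_) (le_abs_self _)
    by_cases hw : σ' (π w) = k
    · have hwk : σ w = k := by
        by_contra hne
        exact (mismatch_mul_swap_lt (by rw [hu]; exact hu'.symm) (by rwa [hw])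
          (hu.trans hw.symm)).not_ge (hπ _)
      simp [hw, hwk]
    · simp only [hw, if_false, sub_zero]
      split_ifs <;> simp
  · push Not at hk
    refine le_trans ?_ (neg_le_abs _)
    rw [← Finset.sum_neg_distrib]
    refine Finset.sum_le_sum fun w _ => ?_
    by_cases hw : σ w = k
    · simp [hw, hk w hw]
    · simp only [hw, if_false, zero_sub, abs_neg, neg_neg]
      split_ifs <;> simp

/-- Advance the color of `v` by one if `b` holds, and do nothing otherwise. -/
def advance {n : ℕ} (σ : Config n) (v : Fin n) (b : Bool) : Config n :=
  if b then Function.update σ v (σ v + 1) else σ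

/-- One step of the coupled chains: matched vertices share the coin `b`, mismatched vertices use
opposite coins. -/
noncomputable def pairStep {n : ℕ} (π : Equiv.Perm (Fin n)) (x : Config n × Config n)
    (v : Fin n) (b : Bool) : Config n × Config n :=
  (advance x.1 v b, advance x.2 (π v) (if x.1 v = x.2 (π v) then b else !b))

/-- The semi-synchronized coupling built from a choice of matchings. -/
noncomputable def semiSync {n : ℕ} (π : Config n × Config n → Equiv.Perm (Fin n)) :
    Matrix (Config n × Config n) (Config n × Config n) ℝ :=
  Matrix.of fun x y => 1 / (n : ℝ) * ∑ v, (1 / 2) * ∑ b : Bool,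
    if y = pairStep (π x) x v b then (1 : ℝ) else 0

theorem semiSync_mulVec {n : ℕ} (π : Config n × Config n → Equiv.Perm (Fin n))
    (g : Config n × Config n → ℝ) (x : Config n × Config n) :
    (semiSync π).mulVec g x = 1 / (n : ℝ) * ∑ v, (1 / 2) * ∑ b : Bool,
      g (pairStep (π x) x v b) := by
  simp only [Matrix.mulVec, dotProduct, semiSync, Matrix.of_apply, mul_assoc]
  rw [← Finset.mul_sum]
  simp only [Finset.sum_mul, mul_assoc]
  rw [Finset.sum_comm]
  congr 1
  refine Finset.sum_congr rfl fun v _ => ?_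
  rw [← Finset.mul_sum, Finset.sum_comm]
  simp

theorem semiSync_isCoupling {n : ℕ} (π : Config n × Config n → Equiv.Perm (Fin n)) :
    IsCoupling n (1 / 2) (semiSync π) := by
  refine ⟨fun x y => ?_, fun x τ => ?_, fun x τ' => ?_⟩
  · simp only [semiSync, Matrix.of_apply]
    positivity
  · simp only [semiSync, Matrix.of_apply, cyclicP]
    rw [← Finset.mul_sum, Finset.sum_comm]
    congr 1
    refine Finset.sum_congr rfl fun v _ => ?_
    rw [← Finset.mul_sum, Finset.sum_comm]
    simp only [pairStep, Prod.mk.injEq, ite_and, Fintype.sum_bool, advance]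
    simp only [Finset.sum_ite_irrel, Finset.sum_ite_eq', Finset.mem_univ,
      Finset.sum_const_zero, if_true]
    simp only [Bool.false_eq_true, if_false]
    ring
  · simp only [semiSync, Matrix.of_apply, cyclicP]
    rw [← Finset.mul_sum, Finset.sum_comm]
    congr 1
    rw [← Equiv.sum_comp (π x) (fun v => (1 - 1 / 2) * (if τ' = x.2 then (1 : ℝ) else 0)
      + 1 / 2 * (if τ' = Function.update x.2 v (x.2 v + 1) then (1 : ℝ) else 0))]
    refine Finset.sum_congr rfl fun v _ => ?_
    rw [← Finset.mul_sum, Finset.sum_comm]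
    simp only [pairStep, Prod.mk.injEq, and_comm (b := τ' = _), ite_and, Fintype.sum_bool, advance]
    by_cases h : x.1 v = x.2 (π x v)
    · simp only [h, Finset.sum_ite_irrel, Finset.sum_ite_eq', Finset.mem_univ,
        Finset.sum_const_zero, if_true]
      simp only [Bool.false_eq_true, if_false]
      ring
    · simp only [h, Finset.sum_ite_irrel, Finset.sum_ite_eq', Finset.mem_univ,
        Finset.sum_const_zero, if_true]
      simp only [Bool.false_eq_true, Bool.not_true, Bool.not_false, if_true, if_false]
      ring

theorem mismatch_pairStep {n : ℕ} (π : Equiv.Perm (Fin n)) (x : Config n × Config n)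
    (v : Fin n) (b : Bool) :
    mismatch (pairStep π x v b).1 (pairStep π x v b).2 π =
      mismatch x.1 x.2 π - (if x.1 v = x.2 (π v) then (0 : ℝ) else 1)
        + if (pairStep π x v b).1 v = (pairStep π x v b).2 (π v) then (0 : ℝ) else 1 := by
  simp only [mismatch]
  rw [← Finset.add_sum_erase _ _ (Finset.mem_univ v),
    ← Finset.add_sum_erase (a := v) univ (fun v => if x.1 v = x.2 (π v) then (0 : ℝ) else 1)
      (Finset.mem_univ v)]
  have herase : ∀ w ∈ univ.erase v,
      (if (pairStep π x v b).1 w = (pairStep π x v b).2 (π w) then (0 : ℝ) else 1) =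
        if x.1 w = x.2 (π w) then (0 : ℝ) else 1 := by
    intro w hw
    have hwv : w ≠ v := Finset.ne_of_mem_erase hw
    have h1 : (pairStep π x v b).1 w = x.1 w := by
      simp only [pairStep, advance]
      split_ifs <;> simp [hwv]
    have h2 : (pairStep π x v b).2 (π w) = x.2 (π w) := by
      simp only [pairStep, advance]
      split_ifs <;> simp [hwv]
    rw [h1, h2]
  rw [Finset.sum_congr rfl herase]
  ring

theorem sum_mismatch_pairStep_le {n : ℕ} (π : Equiv.Perm (Fin n)) (x : Config n × Config n)
    (v : Fin n) :
    ∑ b : Bool, mismatch (pairStep π x v b).1 (pairStep π x v b).2 π ≤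
      2 * mismatch x.1 x.2 π - if x.1 v = x.2 (π v) then (0 : ℝ) else 1 := by
  simp only [mismatch_pairStep, Fintype.sum_bool]
  simp only [pairStep, advance]
  by_cases h : x.1 v = x.2 (π v)
  · simp [h]
    linarith
  · have hcolor : ∀ a c : Fin 3, a ≠ c → a + 1 = c ∨ a = c + 1 := by decide
    rcases hcolor _ _ h with h' | h'
    · simp [h, h']
      split_ifs <;> linarith
    · simp [h, ← h']
      split_ifs <;> linarith

/-- The semi-synchronized coupling along optimal matchings contracts in one step. -/
theorem semiSync_contraction {n : ℕ} (hn : 1 ≤ n)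
    {π : Config n × Config n → Equiv.Perm (Fin n)}
    (hπ : ∀ x, l1 (propVec x.1 - propVec x.2) = 2 / n * mismatch x.1 x.2 (π x))
    (x : Config n × Config n) :
    (semiSync π).mulVec (fun y => l1 (propVec y.1 - propVec y.2)) x ≤
      (1 - 1 / (2 * n)) * l1 (propVec x.1 - propVec x.2) := by
  have hn0 : (n : ℝ) ≠ 0 := by positivity
  rw [semiSync_mulVec, hπ x]
  calc 1 / (n : ℝ) * ∑ v, (1 / 2) * ∑ b : Bool,
        l1 (propVec (pairStep (π x) x v b).1 - propVec (pairStep (π x) x v b).2)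
      ≤ 1 / (n : ℝ) * ∑ v, (1 / 2) * (2 / n * (2 * mismatch x.1 x.2 (π x)
          - if x.1 v = x.2 (π x v) then (0 : ℝ) else 1)) := by
        gcongr with v
        refine le_trans (Finset.sum_le_sum fun b _ => l1_le_mismatch _ _ (π x)) ?_
        rw [← Finset.mul_sum]
        gcongr
        exact sum_mismatch_pairStep_le _ _ _
    _ = (1 - 1 / (2 * n)) * (2 / n * mismatch x.1 x.2 (π x)) := by
        rw [← Finset.mul_sum, ← Finset.mul_sum, Finset.sum_sub_distrib]
        simp only [Finset.sum_const, Finset.card_univ, Fintype.card_fin, nsmul_eq_mul]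
        change _ * (_ * (_ * (_ - mismatch x.1 x.2 (π x)))) = _
        field_simp

theorem matrix_pow_nonneg {α : Type*} [Fintype α] [DecidableEq α] {K : Matrix α α ℝ}
    (hK : ∀ x y, 0 ≤ K x y) (t : ℕ) (x y : α) : 0 ≤ (K ^ t) x y := by
  induction t generalizing x y with
  | zero =>
    rw [pow_zero, Matrix.one_apply]
    split_ifs <;> norm_num
  | succ t ih =>
    rw [pow_succ, Matrix.mul_apply]
    exact Finset.sum_nonneg fun z _ => mul_nonneg (ih x z) (hK z y)

/-- A one-step contraction of a function under a nonnegative kernel iterates. -/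
theorem matrix_pow_mulVec_le {α : Type*} [Fintype α] [DecidableEq α] {K : Matrix α α ℝ}
    (hK : ∀ x y, 0 ≤ K x y) {g : α → ℝ} {c : ℝ} (hc : 0 ≤ c)
    (hg : ∀ x, K.mulVec g x ≤ c * g x) (t : ℕ) (x : α) :
    (K ^ t).mulVec g x ≤ c ^ t * g x := by
  induction t generalizing x with
  | zero => simp
  | succ t ih =>
    rw [pow_succ, ← Matrix.mulVec_mulVec]
    calc (K ^ t).mulVec (K.mulVec g) x ≤ (K ^ t).mulVec (c • g) x :=
          Finset.sum_le_sum fun z _ =>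
            mul_le_mul_of_nonneg_left (hg z) (matrix_pow_nonneg hK t x z)
      _ = c * (K ^ t).mulVec g x := by rw [Matrix.mulVec_smul]; rfl
      _ ≤ c * (c ^ t * g x) := by gcongr; exact ih x
      _ = c ^ (t + 1) * g x := by ring

theorem semiSync_pow_row_sum {n : ℕ} (hn : 1 ≤ n)
    (π : Config n × Config n → Equiv.Perm (Fin n)) (t : ℕ) (x : Config n × Config n) :
    ∑ y, (semiSync π ^ t) x y = 1 := by
  have hn0 : (n : ℝ) ≠ 0 := by positivity
  have hone : (semiSync π).mulVec 1 = 1 := by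
    ext x
    simp [semiSync_mulVec, hn0]
  have hpow : (semiSync π ^ t).mulVec 1 = 1 := by
    induction t with
    | zero => simp
    | succ t ih => rw [pow_succ, ← Matrix.mulVec_mulVec, hone, ih]
  simpa [Matrix.mulVec, dotProduct] using congrFun hpow x

/-- Distinct proportion vectors are at `ℓ¹` distance at least `1 / n`. -/
theorem one_le_mul_l1 {n : ℕ} (hn : 1 ≤ n) {σ σ' : Config n} (h : propVec σ ≠ propVec σ') :
    1 ≤ n * l1 (propVec σ - propVec σ') := by
  have hn0 : (0 : ℝ) < n := by positivity
  obtain ⟨k, hk⟩ := Function.ne_iff.mp h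
  have hle : |(propVec σ - propVec σ') k| ≤ l1 (propVec σ - propVec σ') :=
    Finset.single_le_sum (f := fun k => |(propVec σ - propVec σ') k|)
      (fun k _ => abs_nonneg _) (Finset.mem_univ k)
  refine le_trans ?_ (mul_le_mul_of_nonneg_left hle hn0.le)
  simp only [Pi.sub_apply, propVec] at hk ⊢
  rw [← sub_div, abs_div, Nat.abs_cast, mul_div_cancel₀ _ hn0.ne']
  have hint : ((univ.filter fun v => σ v = k).card : ℤ) -
      (univ.filter fun v => σ' v = k).card ≠ 0 := by
    intro h0
    apply hk
    rw [sub_eq_zero] at h0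
    rw [show (univ.filter fun v => σ v = k).card = (univ.filter fun v => σ' v = k).card from
      by exact_mod_cast h0]
  exact_mod_cast Int.one_le_abs hint

/-- if `‖S_0 − S̃_0‖₁ < 10/n`, then for every `ε > 0` there is a
`γ > 0` (independent of `n`) such that under the semi-synchronized coupling the two
proportion chains coincide at any time `t ≥ γn` with probability at least `1 − ε`. -/
theorem proportion_chains_coalesce (ε : ℝ) (hε : 0 < ε) :
    ∃ γ : ℝ, 0 < γ ∧ ∀ n : ℕ, 1 ≤ n → ∀ σ0 σ0' : Config n,
      l1 (propVec σ0 - propVec σ0') < 10 / (n : ℝ) →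
      ∃ K : Matrix (Config n × Config n) (Config n × Config n) ℝ,
        IsCoupling n (1/2) K ∧ IsSemiSynchronized n K ∧
        ∀ t : ℕ, γ * n ≤ (t : ℝ) →
          1 - ε ≤ ∑ y : Config n × Config n,
            if propVec y.1 = propVec y.2 then (K ^ t) (σ0, σ0') y else 0 := by
  refine ⟨20 / ε, by positivity, fun n hn σ0 σ0' h0 => ?_⟩
  have hn0 : (0 : ℝ) < n := by positivity
  choose π hπ using fun x : Config n × Config n => exists_perm_mismatch_eq x.1 x.2
  have hK := semiSync_isCoupling π
  have hc : (0 : ℝ) ≤ 1 - 1 / (2 * n) := by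
    have : (1 : ℝ) ≤ n := by exact_mod_cast hn
    rw [sub_nonneg, div_le_one (by positivity)]
    linarith
  have hsync : IsSemiSynchronized n (semiSync π) := fun σ σ' t =>
    matrix_pow_mulVec_le hK.1 hc (semiSync_contraction hn hπ) t (σ, σ')
  refine ⟨semiSync π, hK, hsync, fun t ht => ?_⟩
  have hdecay : (1 - 1 / (2 * n : ℝ)) ^ t ≤ ε / 10 := by
    have hexp : 10 / ε ≤ Real.exp (t / (2 * n)) := by
      have hle : 10 / ε ≤ t / (2 * n : ℝ) := by
        rw [le_div_iff₀ (by positivity)]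
        calc 10 / ε * (2 * n) = 20 / ε * n := by ring
          _ ≤ t := ht
      linarith [Real.add_one_le_exp (t / (2 * n : ℝ))]
    calc (1 - 1 / (2 * n : ℝ)) ^ t ≤ Real.exp (-(1 / (2 * n))) ^ t := by
          gcongr
          exact Real.one_sub_le_exp_neg _
      _ = (Real.exp (t / (2 * n)))⁻¹ := by
          rw [← Real.exp_nat_mul, ← Real.exp_neg]
          congr 1
          ring
      _ ≤ (10 / ε)⁻¹ := by gcongr
      _ = ε / 10 := inv_div _ _
  have hmean : n * ∑ y : Config n × Config n,
      (semiSync π ^ t) (σ0, σ0') y * l1 (propVec y.1 - propVec y.2) ≤ ε := by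
    calc _ ≤ n * ((1 - 1 / (2 * n : ℝ)) ^ t * l1 (propVec σ0 - propVec σ0')) := by
          gcongr
          exact hsync σ0 σ0' t
      _ ≤ n * (ε / 10 * (10 / n)) := by
          gcongr
          exact Finset.sum_nonneg fun k _ => abs_nonneg _
      _ = ε := by field_simp
  calc 1 - ε ≤ 1 - n * ∑ y : Config n × Config n,
        (semiSync π ^ t) (σ0, σ0') y * l1 (propVec y.1 - propVec y.2) := by linarith
    _ = ∑ y : Config n × Config n, (semiSync π ^ t) (σ0, σ0') y *
        (1 - n * l1 (propVec y.1 - propVec y.2)) := by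
      simp only [mul_sub, mul_one, Finset.sum_sub_distrib, semiSync_pow_row_sum hn π t (σ0, σ0'),
        Finset.mul_sum, mul_left_comm (n : ℝ)]
    _ ≤ _ := by
      refine Finset.sum_le_sum fun y _ => ?_
      have hnonneg := matrix_pow_nonneg hK.1 t (σ0, σ0') y
      split_ifs with hy
      · simp [hy, l1]
      · exact mul_nonpos_of_nonneg_of_nonpos hnonneg (by linarith [one_le_mul_l1 hn hy])
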